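/- In the abstract linear PDE-constrained setting, the objective J is Fréchet differentiable at every m ∈ M, and its derivative in direction m̃ ∈ M is given by the adjoint-based expression J′(m)(m̃) = ⟨R(m − m_pr), m̃⟩ + c(p, m̃), where u = u(m) is the state solution and p ∈ U is the unique solution of the adjoint equation ⟨Γ⁻¹(Q u − u_obs), Q ũ⟩ + a(p, ũ) = 0 for all ũ ∈ U. -/

import Mathlib

open Matrix
open scoped RealInnerProductSpace

/-- Derivative of half the quadratic form of a symmetric bilinear form along a map. -/
theorem hasFDerivAt_half_symm_bilin {E F : Type*}
    [NormedAddCommGroup E] [NormedSpace ℝ E] [NormedAddCommGroup F] [NormedSpace ℝ F]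
    (B : F →L[ℝ] F →L[ℝ] ℝ) (hB : ∀ x y, B x y = B y x)
    {f : E → F} {f' : E →L[ℝ] F} {x : E} (hf : HasFDerivAt f f' x) :
    HasFDerivAt (fun y => (1 / 2) * B (f y) (f y)) ((B (f x)).comp f') x := by
  refine ((B.hasFDerivAt_of_bilinear hf hf).const_mul (1 / 2)).congr_fderiv ?_
  ext h
  simp [hB (f' h) (f x)]
  ring

/-- The solution map of a linear equation in variational form, with uniquely solvable
bilinear form `a`, is Fréchet differentiable, and its derivative solves the linearized equation. -/
theorem exists_hasFDerivAt_solution {U M : Type*}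
    [NormedAddCommGroup U] [NormedSpace ℝ U] [CompleteSpace U]
    [NormedAddCommGroup M] [NormedSpace ℝ M]
    (a : U →L[ℝ] U →L[ℝ] ℝ) (c : U →L[ℝ] M →L[ℝ] ℝ) (d : U →L[ℝ] ℝ)
    (ha : ∀ ℓ : U →L[ℝ] ℝ, ∃! w : U, ∀ pt : U, a pt w = ℓ pt)
    (u : M → U) (hu : ∀ m : M, ∀ pt : U, a pt (u m) + c pt m + d pt = 0) :
    ∃ L : M →L[ℝ] U, (∀ m, HasFDerivAt u L m) ∧ ∀ pt h, a pt (L h) + c pt h = 0 := by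
  have hinj : Function.Injective a.flip := fun x y hxy =>
    (ha (a.flip y)).unique (fun pt => congrArg (fun ℓ : U →L[ℝ] ℝ => ℓ pt) hxy) fun _ => rfl
  have hsurj : Function.Surjective a.flip := fun ℓ =>
    let ⟨w, hw, _⟩ := ha ℓ
    ⟨w, ContinuousLinearMap.ext hw⟩
  let S : U ≃L[ℝ] (U →L[ℝ] ℝ) := ContinuousLinearEquiv.ofBijective a.flip
    (LinearMap.ker_eq_bot.mpr hinj) (LinearMap.range_eq_top.mpr hsurj)
  have hS : ∀ ℓ pt, a pt (S.symm ℓ) = ℓ pt := fun ℓ pt =>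
    congrArg (fun ℓ : U →L[ℝ] ℝ => ℓ pt) (S.apply_symm_apply ℓ)
  let L : M →L[ℝ] U := -((S.symm : (U →L[ℝ] ℝ) →L[ℝ] U).comp c.flip)
  have hL : ∀ pt h, a pt (L h) = -c pt h := fun pt h => by simp [L, hS]
  have huL : u = fun m => L m + S.symm (-d) := by
    funext m
    refine hinj (ContinuousLinearMap.ext fun pt => ?_)
    simp only [ContinuousLinearMap.flip_apply, (a pt).map_add, hL, hS, _root_.neg_apply]
    linarith [hu m pt]
  refine ⟨L, fun m => ?_, fun pt h => by simp [hL]⟩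
  rw [huL]
  exact L.hasFDerivAt.add_const _

/-- Adjoint-based expression for the Fréchet derivative of the regularized data-misfit
objective in the abstract linear PDE-constrained setting. -/
theorem stmt_11 {U M : Type*}
    [NormedAddCommGroup U] [InnerProductSpace ℝ U] [CompleteSpace U]
    [NormedAddCommGroup M] [InnerProductSpace ℝ M] [CompleteSpace M]
    {q : ℕ}
    (a : U →L[ℝ] U →L[ℝ] ℝ) (c : U →L[ℝ] M →L[ℝ] ℝ) (d : U →L[ℝ] ℝ)
    (ha₁ : ∀ ℓ : U →L[ℝ] ℝ, ∃! w : U, ∀ pt : U, a pt w = ℓ pt)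
    (ha₂ : ∀ ℓ : U →L[ℝ] ℝ, ∃! v : U, ∀ ut : U, a v ut = ℓ ut)
    (Q : U →L[ℝ] (Fin q → ℝ)) (Γ : Matrix (Fin q) (Fin q) ℝ) (hΓ : Γ.PosDef)
    (uobs : Fin q → ℝ) (mpr : M)
    (R : M →L[ℝ] M) (hR : ∀ x y : M, ⟪R x, y⟫ = ⟪x, R y⟫)
    (hR₀ : ∀ x : M, 0 ≤ ⟪R x, x⟫)
    (u : M → U) (hu : ∀ m : M, ∀ pt : U, a pt (u m) + c pt m + d pt = 0)
    (J : M → ℝ)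
    (hJ : ∀ m : M, J m =
      (1 / 2) * ((Γ⁻¹ *ᵥ (Q (u m) - uobs)) ⬝ᵥ (Q (u m) - uobs))
        + (1 / 2) * ⟪R (m - mpr), m - mpr⟫) :
    ∀ m : M, ∀ p : U,
      (∀ ut : U, (Γ⁻¹ *ᵥ (Q (u m) - uobs)) ⬝ᵥ (Q ut) + a p ut = 0) →
      HasFDerivAt J (innerSL ℝ (R (m - mpr)) + c p) m := by
  intro m p hp
  obtain ⟨L, hL, hLc⟩ := exists_hasFDerivAt_solution a c d ha₁ u hu
  let G : (Fin q → ℝ) →L[ℝ] (Fin q → ℝ) →L[ℝ] ℝ :=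
    (Matrix.toLinearMap₂' ℝ Γ⁻¹).toContinuousBilinearMap
  have hΓt : (Γ⁻¹)ᵀ = Γ⁻¹ := by
    simpa [Matrix.IsHermitian, Matrix.conjTranspose_eq_transpose_of_trivial]
      using hΓ.isHermitian.inv
  have hG : ∀ x y, G x y = (Γ⁻¹ *ᵥ x) ⬝ᵥ y := fun x y => by
    simp only [G, LinearMap.toContinuousBilinearMap_apply, Matrix.toLinearMap₂'_apply']
    rw [Matrix.dotProduct_mulVec, ← Matrix.mulVec_transpose, hΓt]
  have hGsymm : ∀ x y, G x y = G y x := fun x y => by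
    rw [hG y x, dotProduct_comm]
    simp only [G, LinearMap.toContinuousBilinearMap_apply, Matrix.toLinearMap₂'_apply']
  have hres : HasFDerivAt (fun m => Q (u m) - uobs) (Q.comp L) m :=
    (Q.hasFDerivAt.comp m (hL m)).sub_const uobs
  have hmisfit := hasFDerivAt_half_symm_bilin G hGsymm hres
  have hreg := hasFDerivAt_half_symm_bilin ((innerSL ℝ).comp R)
    (fun x y => by simpa using (hR x y).trans (real_inner_comm _ _))
    ((hasFDerivAt_id m).sub_const mpr)
  have hJ' : J = fun m => (1 / 2) * G (Q (u m) - uobs) (Q (u m) - uobs)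
      + (1 / 2) * ((innerSL ℝ).comp R) (id m - mpr) (id m - mpr) := by
    funext m
    rw [hJ, hG]
    rfl
  rw [hJ']
  refine (hmisfit.add hreg).congr_fderiv ?_
  ext h
  have hadj : G (Q (u m) - uobs) (Q (L h)) = c p h := by
    rw [hG]
    linarith [hp (L h), hLc p h]
  simp [-map_sub, hadj, add_comm]
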